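/- Let xᵢ, x₁, x₂ be points of the Euclidean plane with pairwise distances at least 2, and suppose there exist y ∈ ℝ² and r < 2 with dist y xᵢ = dist y x₁ = dist y x₂ = r. Then the area of the L-triangle with vertices xᵢ, x₁, x₂ is at least √3; writing a = x₁ − xᵢ and b = x₂ − xᵢ, this says (1/2)·|a₀·b₁ − a₁·b₀| ≥ √3. -/

import Mathlib

/-- If the squared sides `A`, `B`, `C` of a triangle are at least `4`, with `C` the largest, and its
circumradius is at most `2`, then the square `E` of twice its area is at least `12`. -/
lemma twelve_le_of_largest_side {A B C E : ℝ} (hA : 4 ≤ A) (hB : 4 ≤ B)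
    (hAC : A ≤ C) (hBC : B ≤ C)
    (hE : 4 * E = 4 * (A * B) - (A + B - C) ^ 2) (hR : A * B * C ≤ 16 * E) : 12 ≤ E := by
  have hAB : 16 ≤ A * B := by nlinarith
  by_contra! h
  have hq : A * B < (A + B - C) ^ 2 := by nlinarith
  have hneg : A + B - C < 0 := by
    by_contra! h0
    nlinarith [mul_le_mul (show A + B - C ≤ A by linarith) (show A + B - C ≤ B by linarith) h0
      (by linarith)]
  have h4 : A + B - C < -4 := by nlinarith
  have hC : 12 < C := by linarith
  nlinarith

/-- The same bound without an ordering of the sides. -/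
lemma twelve_le_of_sides {A B C E : ℝ} (hA : 4 ≤ A) (hB : 4 ≤ B) (hC : 4 ≤ C)
    (hE : 4 * E = 4 * (A * B) - (A + B - C) ^ 2) (hR : A * B * C ≤ 16 * E) : 12 ≤ E := by
  rcases le_total A C with h1 | h1 <;> rcases le_total B C with h2 | h2
  · exact twelve_le_of_largest_side hA hB h1 h2 hE hR
  · exact twelve_le_of_largest_side hA hC (h1.trans h2) h2 (by linarith) (by linarith)
  · exact twelve_le_of_largest_side hC hB h1 (h2.trans h1) (by linarith) (by linarith)
  · rcases le_total A B with h3 | h3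
    · exact twelve_le_of_largest_side hA hC h3 h2 (by linarith) (by linarith)
    · exact twelve_le_of_largest_side hC hB h1 h3 (by linarith) (by linarith)

/-- The law of sines in squared form, for the triangle with vertices `0`, `(a, b)`, `(c, d)` and
circumcenter `(p, q)`. -/
lemma four_mul_det_sq_mul_circumradius_sq {a b c d p q : ℝ}
    (h₁ : 2 * (p * a + q * b) = a ^ 2 + b ^ 2) (h₂ : 2 * (p * c + q * d) = c ^ 2 + d ^ 2) :
    4 * (a * d - b * c) ^ 2 * (p ^ 2 + q ^ 2) =
      (a ^ 2 + b ^ 2) * (c ^ 2 + d ^ 2) * ((a - c) ^ 2 + (b - d) ^ 2) := by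
  have hp : 2 * (a * d - b * c) * p = (a ^ 2 + b ^ 2) * d - (c ^ 2 + d ^ 2) * b := by
    linear_combination d * h₁ - b * h₂
  have hq : 2 * (a * d - b * c) * q = (c ^ 2 + d ^ 2) * a - (a ^ 2 + b ^ 2) * c := by
    linear_combination a * h₂ - c * h₁
  calc 4 * (a * d - b * c) ^ 2 * (p ^ 2 + q ^ 2)
      = (2 * (a * d - b * c) * p) ^ 2 + (2 * (a * d - b * c) * q) ^ 2 := by ring
    _ = _ := by rw [hp, hq]; ring

lemma dist_sq_eq_fin_two (x y : EuclideanSpace ℝ (Fin 2)) :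
    dist x y ^ 2 = (x 0 - y 0) ^ 2 + (x 1 - y 1) ^ 2 := by
  rw [EuclideanSpace.dist_eq, Real.sq_sqrt (by positivity)]
  simp [Fin.sum_univ_two, Real.dist_eq, sq_abs]

theorem L_triangle_area_ge_sqrt_three
    (xi x₁ x₂ : EuclideanSpace ℝ (Fin 2))
    (h₁ : dist xi x₁ ≥ 2) (h₂ : dist xi x₂ ≥ 2) (h₁₂ : dist x₁ x₂ ≥ 2)
    (y : EuclideanSpace ℝ (Fin 2)) (r : ℝ) (hr : r < 2)
    (hy₀ : dist y xi = r) (hy₁ : dist y x₁ = r) (hy₂ : dist y x₂ = r) :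
    (1 / 2) * |(x₁ - xi) 0 * (x₂ - xi) 1 - (x₁ - xi) 1 * (x₂ - xi) 0| ≥
      Real.sqrt 3 := by
  have hr0 : 0 ≤ r := hy₀ ▸ dist_nonneg
  have hr4 : r ^ 2 ≤ 4 := by nlinarith
  have e₁ : 4 ≤ dist xi x₁ ^ 2 := by nlinarith
  have e₂ : 4 ≤ dist xi x₂ ^ 2 := by nlinarith
  have e₁₂ : 4 ≤ dist x₁ x₂ ^ 2 := by nlinarith
  have f₀ := dist_sq_eq_fin_two y xi
  have f₁ := dist_sq_eq_fin_two y x₁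
  have f₂ := dist_sq_eq_fin_two y x₂
  rw [hy₀] at f₀
  rw [hy₁] at f₁
  rw [hy₂] at f₂
  rw [dist_sq_eq_fin_two] at e₁ e₂ e₁₂
  simp only [PiLp.sub_apply]
  have key := four_mul_det_sq_mul_circumradius_sq
    (a := x₁ 0 - xi 0) (b := x₁ 1 - xi 1) (c := x₂ 0 - xi 0) (d := x₂ 1 - xi 1)
    (p := y 0 - xi 0) (q := y 1 - xi 1) (by linarith) (by linarith)
  rw [← f₀] at key
  set D := (x₁ 0 - xi 0) * (x₂ 1 - xi 1) - (x₁ 1 - xi 1) * (x₂ 0 - xi 0) with hD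
  have hD12 : 12 ≤ D ^ 2 := by
    refine twelve_le_of_sides e₁ e₂ e₁₂ (by rw [hD]; ring) ?_
    calc _ = 4 * D ^ 2 * r ^ 2 := by rw [key]; ring
      _ ≤ 4 * D ^ 2 * 4 := by gcongr
      _ = 16 * D ^ 2 := by ring
  refine Real.sqrt_le_iff.mpr ⟨by positivity, ?_⟩
  rw [mul_pow, sq_abs]
  linarith
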